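/- arXiv:0909.1338 — 4 statements merged into one kernel-verified Lean document; each statement's English description precedes it below -/
import Mathlib

section
/- (Modulation induced by ROSS) Let {g_i, h_i}_{i∈{0,1}} be a perfect reconstruction filterbank with finitely supported filters that satisfies the analysis–synthesis symmetry with parameters (a,b). Then for all ω ∈ ℝ: ĝ̃_1(ω)·ĥ_0(ω) − ĝ̃_0(ω)·ĥ_1(ω) = 0 and ĝ̃_1(ω)·ĥ_0(ω−π) − ĝ̃_0(ω)·ĥ_1(ω−π) = 2, where g̃_0, g̃_1 are the complementary analysis filters. -/
open scoped BigOperators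

noncomputable section

/-- Discrete convolution `(f ⋆ x)[n] = Σ_m f[m]·x[n−m]` (a finite sum when `f` is
finitely supported). -/
def conv (f x : ℤ → ℝ) (n : ℤ) : ℝ := ∑ᶠ m : ℤ, f m * x (n - m)

/-- One-level filterbank coefficient `v^x_i[n] = (g_i ⋆ x)[2n]`. -/
def fbCoeff (g x : ℤ → ℝ) (n : ℤ) : ℝ := conv g x (2 * n)

/-- Perfect reconstruction filterbank:
`x[n] = Σ_{i∈{0,1}} Σ_m h_i[n−2m]·v^x_i[m]` for all `x` and `n`. -/
def IsPR (g h : ZMod 2 → ℤ → ℝ) : Prop :=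
  ∀ (x : ℤ → ℝ) (n : ℤ),
    x n = ∑ i : ZMod 2, ∑ᶠ m : ℤ, h i (n - 2 * m) * fbCoeff (g i) x m

/-- Discrete-time Fourier transform `f̂(ω) = Σ_n f[n]·exp(−i·n·ω)`. -/
def dtft (f : ℤ → ℝ) (ω : ℝ) : ℂ :=
  ∑ᶠ n : ℤ, (f n : ℂ) * Complex.exp (-(Complex.I * (n : ℂ) * (ω : ℂ)))

/-- Analysis–synthesis symmetry with parameters `(a, b)`:
`ĝ_i(ω) = (−1)^{1−i}·a·exp(i(2b+1)ω)·ĥ_{1−i}(ω−π)`. -/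
def SymmAS (g h : ZMod 2 → ℤ → ℝ) (a : ℝ) (b : ℤ) : Prop :=
  ∀ (i : ZMod 2) (ω : ℝ),
    dtft (g i) ω
      = (-1 : ℂ) ^ (1 - i : ZMod 2).val * (a : ℂ)
        * Complex.exp (Complex.I * (2 * (b : ℂ) + 1) * (ω : ℂ))
        * dtft (h (1 - i)) (ω - Real.pi)

/-- Complementary analysis filter `g̃_i[n] = a·h_i[n + 2b + 1]`. -/
def compG (a : ℝ) (b : ℤ) (h : ℤ → ℝ) (n : ℤ) : ℝ := a * h (n + (2 * b + 1))

/-- Complementary synthesis filter `h̃_i[n] = a⁻¹·g_i[n − (2b + 1)]`. -/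
def compH (a : ℝ) (b : ℤ) (g : ℤ → ℝ) (n : ℤ) : ℝ := a⁻¹ * g (n - (2 * b + 1))

/-- Modulated sequence `x_m[n] = (−1)^n·x[n]`. -/
def modSeq (x : ℤ → ℝ) (n : ℤ) : ℝ := (-1 : ℝ) ^ n * x n

/-- Subsampled sequence: `x_s[n] = x[n]` for even `n`, and `0` for odd `n`. -/
def subSeq (x : ℤ → ℝ) (n : ℤ) : ℝ := if Even n then x n else 0

/-- Haar analysis filters: `g_i[0] = 1`, `g_i[−1] = (−1)^i`, else `0`. -/
def haarG (i : ZMod 2) (n : ℤ) : ℝ :=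
  if n = 0 then 1 else if n = -1 then (-1 : ℝ) ^ i.val else 0

/-- Haar synthesis filters: `h_i[0] = 1/2`, `h_i[1] = (−1)^i/2`, else `0`. -/
def haarH (i : ZMod 2) (n : ℤ) : ℝ :=
  if n = 0 then 1 / 2 else if n = 1 then (-1 : ℝ) ^ i.val / 2 else 0

/-- `L`-level filterbank coefficients `v^x_𝐢`; the bit `𝐢 0` is the level-0 bit,
applied first, then the remaining levels recursively. -/
def mCoeff (g : ZMod 2 → ℤ → ℝ) : (L : ℕ) → (Fin L → ZMod 2) → (ℤ → ℝ) → ℤ → ℝ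
  | 0, _, x => x
  | L + 1, i, x => mCoeff g L (fun t => i t.succ) (fbCoeff (g (i 0)) x)

/-- `L`-level complementary coefficients `w^x_𝐢`: identical to `mCoeff` except that
the level-0 filter is taken from the complementary bank `gt`. -/
def mCoeffW (g gt : ZMod 2 → ℤ → ℝ) : (L : ℕ) → (Fin L → ZMod 2) → (ℤ → ℝ) → ℤ → ℝ
  | 0, _, x => x
  | L + 1, i, x => mCoeff g L (fun t => i t.succ) (fbCoeff (gt (i 0)) x)

/-- `𝐢′`: flip the level-0 bit of `𝐢`. -/
def flip0 {L : ℕ} (i : Fin (L + 1) → ZMod 2) : Fin (L + 1) → ZMod 2 :=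
  Function.update i 0 (1 - i 0)

theorem finite_support_dtft_summand {f : ℤ → ℝ} (hf : (Function.support f).Finite) (ω : ℝ) :
    (Function.support fun n : ℤ =>
      (f n : ℂ) * Complex.exp (-(Complex.I * (n : ℂ) * (ω : ℂ)))).Finite :=
  hf.subset fun n hn hfn => hn (by simp [hfn])

theorem dtft_const_mul (c : ℝ) (f : ℤ → ℝ) (ω : ℝ) :
    dtft (fun n => c * f n) ω = (c : ℂ) * dtft f ω := by
  simp only [dtft, ← smul_eq_mul (a := (c : ℂ)), smul_finsum]
  exact finsum_congr fun n => by simp [mul_assoc]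

theorem dtft_comp_sub (f : ℤ → ℝ) (k : ℤ) (ω : ℝ) :
    dtft (fun n => f (n - k)) ω
      = Complex.exp (-(Complex.I * (k : ℂ) * (ω : ℂ))) * dtft f ω := by
  unfold dtft
  rw [← smul_eq_mul, smul_finsum, ← finsum_comp_equiv (Equiv.addRight k)]
  refine finsum_congr fun n => ?_
  simp only [Equiv.coe_addRight, add_sub_cancel_right, smul_eq_mul]
  rw [mul_left_comm, ← Complex.exp_add]
  congr 2
  push_cast
  ring

theorem dtft_finset_sum {ι : Type*} (s : Finset ι) (f : ι → ℤ → ℝ)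
    (hf : ∀ i ∈ s, (Function.support (f i)).Finite) (ω : ℝ) :
    dtft (fun n => ∑ i ∈ s, f i n) ω = ∑ i ∈ s, dtft (f i) ω := by
  unfold dtft
  rw [← finsum_sum_comm s _ fun i hi => finite_support_dtft_summand (hf i hi) ω]
  exact finsum_congr fun n => by push_cast; rw [Finset.sum_mul]

theorem finite_support_comp_sub_mul {h : ℤ → ℝ} (hh : (Function.support h).Finite) (k : ℤ)
    (c : ℝ) : (Function.support fun n => c * h (n - k)).Finite := by
  refine (hh.preimage (sub_left_injective (b := k)).injOn).subset fun n hn => ?_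
  exact right_ne_zero_of_mul hn

/-- Interpolation sum of upsampled coefficients as a finite sum of shifts. -/
theorem finsum_upsample_eq_sum (h : ℤ → ℝ) {c : ℤ → ℝ} (hc : (Function.support c).Finite)
    (n : ℤ) :
    ∑ᶠ m : ℤ, h (n - 2 * m) * c m = ∑ m ∈ hc.toFinset, c m * h (n - 2 * m) := by
  rw [finsum_eq_sum_of_support_subset (s := hc.toFinset)]
  · exact Finset.sum_congr rfl fun m _ => mul_comm _ _
  · intro m hm
    simpa using right_ne_zero_of_mul hm

theorem finite_support_upsample {h c : ℤ → ℝ} (hh : (Function.support h).Finite)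
    (hc : (Function.support c).Finite) :
    (Function.support fun n => ∑ᶠ m : ℤ, h (n - 2 * m) * c m).Finite := by
  simp only [finsum_upsample_eq_sum h hc]
  refine (hc.toFinset.finite_toSet.biUnion fun m _ =>
    finite_support_comp_sub_mul hh (2 * m) (c m)).subset fun n hn => ?_
  obtain ⟨m, hm, hne⟩ := Finset.exists_ne_zero_of_sum_ne_zero hn
  exact Set.mem_biUnion hm hne

theorem dtft_upsample {h c : ℤ → ℝ} (hh : (Function.support h).Finite)
    (hc : (Function.support c).Finite) (ω : ℝ) :
    dtft (fun n => ∑ᶠ m : ℤ, h (n - 2 * m) * c m) ω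
      = dtft h ω * ∑ᶠ m : ℤ, (c m : ℂ) * Complex.exp (-(Complex.I * ((2 * m : ℤ) : ℂ) * (ω : ℂ))) := by
  simp only [finsum_upsample_eq_sum h hc]
  rw [dtft_finset_sum _ _ fun m _ => finite_support_comp_sub_mul hh (2 * m) (c m),
    finsum_eq_sum_of_support_subset (s := hc.toFinset), Finset.mul_sum]
  · refine Finset.sum_congr rfl fun m _ => ?_
    rw [dtft_const_mul, dtft_comp_sub]
    ring
  · intro m hm
    simpa using left_ne_zero_of_mul hm

theorem finsum_int_eq_even_add_odd {F : ℤ → ℂ} (hF : (Function.support F).Finite) :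
    ∑ᶠ n : ℤ, F n = ∑ᶠ m : ℤ, F (2 * m) + ∑ᶠ m : ℤ, F (2 * m - 1) := by
  have he : Function.Injective fun m : ℤ => 2 * m := fun x y hxy => by
    simp only at hxy; omega
  have ho : Function.Injective fun m : ℤ => 2 * m - 1 := fun x y hxy => by
    simp only at hxy; omega
  have hu : (Set.univ : Set ℤ)
      = Set.range (fun m : ℤ => 2 * m) ∪ Set.range (fun m : ℤ => 2 * m - 1) := by
    ext n
    simp only [Set.mem_univ, Set.mem_union, Set.mem_range, true_iff]
    rcases Int.even_or_odd' n with ⟨k, hk | hk⟩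
    · exact Or.inl ⟨k, hk.symm⟩
    · exact Or.inr ⟨k + 1, by omega⟩
  have hd : Disjoint (Set.range fun m : ℤ => 2 * m) (Set.range fun m : ℤ => 2 * m - 1) := by
    rw [Set.disjoint_left]
    rintro _ ⟨x, rfl⟩ ⟨y, hy⟩
    simp only at hy
    omega
  rw [← finsum_mem_univ, hu, finsum_mem_union' hd (hF.inter_of_right _) (hF.inter_of_right _),
    finsum_mem_range he, finsum_mem_range ho]

theorem fbCoeff_single (g : ℤ → ℝ) (k m : ℤ) :
    fbCoeff g (Pi.single k 1) m = g (2 * m - k) := by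
  unfold fbCoeff conv
  rw [finsum_eq_single _ (2 * m - k)]
  · simp
  · intro j hj
    rw [Pi.single_eq_of_ne (by omega), mul_zero]

theorem dtft_single (k : ℤ) (ω : ℝ) :
    dtft (Pi.single k 1) ω = Complex.exp (-(Complex.I * (k : ℂ) * (ω : ℂ))) := by
  unfold dtft
  rw [finsum_eq_single _ k]
  · simp
  · intro j hj
    simp [Pi.single_eq_of_ne hj]

/-- The polyphase component with offset `k` of a perfect reconstruction filterbank. -/
theorem IsPR.sum_dtft_mul_polyphase {g h : ZMod 2 → ℤ → ℝ}
    (hg : ∀ i, (Function.support (g i)).Finite) (hh : ∀ i, (Function.support (h i)).Finite)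
    (hPR : IsPR g h) (k : ℤ) (ω : ℝ) :
    ∑ i : ZMod 2, dtft (h i) ω * ∑ᶠ m : ℤ, (g i (2 * m - k) : ℂ)
      * Complex.exp (-(Complex.I * ((2 * m - k : ℤ) : ℂ) * (ω : ℂ))) = 1 := by
  have hc : ∀ i, (Function.support fun m : ℤ => g i (2 * m - k)).Finite := fun i =>
    (hg i).preimage (f := fun m : ℤ => 2 * m - k) fun x _ y _ hxy => by
      simp only at hxy; omega
  have hδ : (Pi.single k 1 : ℤ → ℝ)
      = fun n => ∑ i : ZMod 2, ∑ᶠ m : ℤ, h i (n - 2 * m) * g i (2 * m - k) := by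
    funext n
    simpa only [fbCoeff_single] using hPR (Pi.single k 1) n
  have hsum := congrArg (fun x => dtft x ω) hδ
  rw [dtft_single, dtft_finset_sum _ _ fun i _ => finite_support_upsample (hh i) (hc i)] at hsum
  have hexp : (1 : ℂ) = Complex.exp (Complex.I * (k : ℂ) * (ω : ℂ))
      * Complex.exp (-(Complex.I * (k : ℂ) * (ω : ℂ))) := by
    rw [← Complex.exp_add, add_neg_cancel, Complex.exp_zero]
  rw [hexp, hsum, Finset.mul_sum]
  refine Finset.sum_congr rfl fun i _ => ?_
  rw [dtft_upsample (hh i) (hc i), mul_left_comm]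
  congr 1
  rw [← smul_eq_mul, smul_finsum]
  refine finsum_congr fun m => ?_
  rw [smul_eq_mul, mul_left_comm, ← Complex.exp_add]
  congr 2
  push_cast
  ring

theorem IsPR.sum_dtft_mul_dtft {g h : ZMod 2 → ℤ → ℝ}
    (hg : ∀ i, (Function.support (g i)).Finite) (hh : ∀ i, (Function.support (h i)).Finite)
    (hPR : IsPR g h) (ω : ℝ) :
    ∑ i : ZMod 2, dtft (h i) ω * dtft (g i) ω = 2 := by
  have he := hPR.sum_dtft_mul_polyphase hg hh 0 ω
  have ho := hPR.sum_dtft_mul_polyphase hg hh 1 ω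
  simp only [sub_zero] at he
  refine Eq.trans ?_ ((congrArg₂ (· + ·) he ho).trans one_add_one_eq_two)
  rw [← Finset.sum_add_distrib]
  refine Finset.sum_congr rfl fun i _ => ?_
  rw [← mul_add]
  congr 1
  exact finsum_int_eq_even_add_odd (finite_support_dtft_summand (hg i) ω)

theorem dtft_compG (a : ℝ) (b : ℤ) (h : ℤ → ℝ) (ω : ℝ) :
    dtft (compG a b h) ω
      = (a : ℂ) * Complex.exp (Complex.I * (2 * (b : ℂ) + 1) * (ω : ℂ)) * dtft h ω := by
  have hcomp : compG a b h = fun n => a * h (n - -(2 * b + 1)) := by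
    funext n
    rw [compG, sub_neg_eq_add]
  rw [hcomp, dtft_const_mul, dtft_comp_sub, ← mul_assoc]
  congr 3
  push_cast
  ring

/-- Modulation induced by ROSS. -/
theorem modulation_induced_by_ROSS (g h : ZMod 2 → ℤ → ℝ)
    (hg : ∀ i : ZMod 2, (Function.support (g i)).Finite)
    (hh : ∀ i : ZMod 2, (Function.support (h i)).Finite)
    (a : ℝ) (b : ℤ) (ha : a ≠ 0)
    (hPR : IsPR g h) (hsym : SymmAS g h a b) :
    ∀ ω : ℝ,
      dtft (compG a b (h 1)) ω * dtft (h 0) ω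
        - dtft (compG a b (h 0)) ω * dtft (h 1) ω = 0 ∧
      dtft (compG a b (h 1)) ω * dtft (h 0) (ω - Real.pi)
        - dtft (compG a b (h 0)) ω * dtft (h 1) (ω - Real.pi) = 2 := by
  intro ω
  simp only [dtft_compG]
  refine ⟨by ring, ?_⟩
  have hsum : dtft (h 0) ω * dtft (g 0) ω + dtft (h 1) ω * dtft (g 1) ω = 2 := by
    rw [← hPR.sum_dtft_mul_dtft hg hh ω]
    exact (Fin.sum_univ_two fun i : ZMod 2 => dtft (h i) ω * dtft (g i) ω).symm
  have hv : (1 : ZMod 2).val = 1 := rfl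
  rw [hsym 0 ω, hsym 1 ω] at hsum
  simp only [sub_zero, sub_self, hv, ZMod.val_zero, pow_zero, pow_one] at hsum
  linear_combination hsum
end
end

section
/- (Filterbank interpretation of ROSS modulation) Let {g_i, h_i}_{i∈{0,1}} be a perfect reconstruction filterbank with finitely supported filters that satisfies the analysis–synthesis symmetry with parameters (a,b). Then synthesis from the reverse-ordered complementary coefficients yields the modulated signal: for every x : ℤ → ℝ and n ∈ ℤ, Σ_m h_0[n−2m]·w^x_1[m] − Σ_m h_1[n−2m]·w^x_0[m] = (−1)^n·x[n]. -/
open scoped BigOperators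

noncomputable section

/-- The character `ω ↦ exp(−i·n·ω)` of the additive group of real numbers. -/
def dtftChar (n : ℤ) : Multiplicative ℝ →* ℂ where
  toFun ω := Complex.exp (-(Complex.I * (n : ℂ) * ((Multiplicative.toAdd ω : ℝ) : ℂ)))
  map_one' := by simp
  map_mul' x y := by
    rw [← Complex.exp_add]
    congr 1
    simp only [toAdd_mul]
    push_cast
    ring

theorem dtftChar_injective : Function.Injective dtftChar := by
  intro m n hmn
  by_contra hne
  have hc : (m : ℂ) - n ≠ 0 := sub_ne_zero.mpr (by exact_mod_cast hne)
  have h1 : Complex.exp (-(Complex.I * (m : ℂ) * ((Real.pi / ((m : ℝ) - n) : ℝ) : ℂ)))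
      = Complex.exp (-(Complex.I * (n : ℂ) * ((Real.pi / ((m : ℝ) - n) : ℝ) : ℂ))) :=
    DFunLike.congr_fun hmn (Multiplicative.ofAdd (Real.pi / ((m : ℝ) - n)))
  have h2 : -(Complex.I * (n : ℂ) * ((Real.pi / ((m : ℝ) - n) : ℝ) : ℂ))
      = -(Complex.I * (m : ℂ) * ((Real.pi / ((m : ℝ) - n) : ℝ) : ℂ)) + Real.pi * Complex.I := by
    push_cast
    field_simp
    ring
  rw [h2, Complex.exp_add, Complex.exp_pi_mul_I] at h1
  have h3 := Complex.exp_ne_zero (-(Complex.I * (m : ℂ) * ((Real.pi / ((m : ℝ) - n) : ℝ) : ℂ)))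
  apply h3
  linear_combination h1 / 2

/-- A finitely supported sequence is determined by its discrete-time Fourier transform. -/
theorem eq_of_dtft_eq {f f' : ℤ → ℝ} (hf : (Function.support f).Finite)
    (hf' : (Function.support f').Finite) (h : ∀ ω, dtft f ω = dtft f' ω) : f = f' := by
  have hli : LinearIndependent ℂ (fun n : ℤ => (dtftChar n : Multiplicative ℝ → ℂ)) :=
    (linearIndependent_monoidHom (Multiplicative ℝ) ℂ).comp dtftChar dtftChar_injective
  set s : Finset ℤ := hf.toFinset ∪ hf'.toFinset
  have hs : ∀ u : ℤ → ℝ, Function.support u ⊆ s → ∀ ω, dtft u ω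
      = ∑ n ∈ s, (u n : ℂ) * Complex.exp (-(Complex.I * (n : ℂ) * (ω : ℂ))) := by
    intro u hu ω
    refine finsum_eq_sum_of_support_subset _ fun n hn => hu ?_
    simp only [Function.mem_support] at hn ⊢
    intro h0
    simp [h0] at hn
  have hsf : Function.support f ⊆ s := by simp [s]
  have hsf' : Function.support f' ⊆ s := by simp [s]
  have hzero := linearIndependent_iff'.mp hli s (fun n => (f n : ℂ) - f' n) <| by
    funext ω
    have h1 := h (Multiplicative.toAdd ω)
    rw [hs f hsf, hs f' hsf', ← sub_eq_zero, ← Finset.sum_sub_distrib] at h1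
    simpa [dtftChar, sub_mul] using h1
  funext n
  by_cases hn : n ∈ s
  · exact_mod_cast sub_eq_zero.mp (hzero n hn)
  · rw [Function.notMem_support.mp fun h0 => hn (hsf h0),
      Function.notMem_support.mp fun h0 => hn (hsf' h0)]

/-- Modulating, scaling and shifting a sequence in time, seen in the frequency domain. -/
theorem dtft_modSeq_shift (f : ℤ → ℝ) (c : ℝ) (k : ℤ) (ω : ℝ) :
    dtft (fun n => c * modSeq f (n + k)) ω
      = c * Complex.exp (Complex.I * (k : ℂ) * (ω : ℂ)) * dtft f (ω - Real.pi) := by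
  unfold dtft
  rw [← smul_eq_mul (_ * _), smul_finsum,
    ← finsum_comp_equiv (Equiv.addRight k) (f := fun n : ℤ => _ • ((f n : ℂ) * _))]
  refine finsum_congr fun n => ?_
  have hpi : Complex.exp (Complex.I * ((n + k : ℤ) : ℂ) * Real.pi) = (-1 : ℂ) ^ (n + k) := by
    rw [← Complex.exp_pi_mul_I, ← Complex.exp_int_mul]
    congr 1
    ring
  have hexp : Complex.exp (-(Complex.I * ((n + k : ℤ) : ℂ) * ((ω - Real.pi : ℝ) : ℂ)))
      = Complex.exp (-(Complex.I * (n : ℂ) * (ω : ℂ)))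
        * Complex.exp (-(Complex.I * (k : ℂ) * (ω : ℂ))) * (-1 : ℂ) ^ (n + k) := by
    rw [← hpi, ← Complex.exp_add, ← Complex.exp_add]
    congr 1
    push_cast
    ring
  have hinv : Complex.exp (Complex.I * (k : ℂ) * (ω : ℂ))
      * Complex.exp (-(Complex.I * (k : ℂ) * (ω : ℂ))) = 1 := by
    rw [← Complex.exp_add, add_neg_cancel, Complex.exp_zero]
  simp only [Equiv.coe_addRight, smul_eq_mul, modSeq]
  rw [hexp]
  push_cast
  linear_combination (-(c : ℂ) * (f (n + k) : ℂ) * (-1 : ℂ) ^ (n + k)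
    * Complex.exp (-(Complex.I * (n : ℂ) * (ω : ℂ)))) * hinv

/-- The analysis–synthesis symmetry in the time domain. -/
theorem SymmAS.eq_modSeq_shift {g h : ZMod 2 → ℤ → ℝ} {a : ℝ} {b : ℤ} (hsym : SymmAS g h a b)
    (hg : ∀ i, (Function.support (g i)).Finite) (hh : ∀ i, (Function.support (h i)).Finite)
    (i : ZMod 2) :
    g i = fun n => (-1 : ℝ) ^ (1 - i : ZMod 2).val * a * modSeq (h (1 - i)) (n + (2 * b + 1)) := by
  refine eq_of_dtft_eq (hg i) ?_ fun ω => ?_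
  · refine ((hh (1 - i)).preimage (add_left_injective (2 * b + 1)).injOn).subset fun n hn => ?_
    simp only [Set.mem_preimage, Function.mem_support] at hn ⊢
    intro h0
    simp [modSeq, h0] at hn
  · rw [hsym, dtft_modSeq_shift]
    push_cast
    rfl

theorem neg_one_zpow_add_odd (n b : ℤ) : (-1 : ℝ) ^ (n + (2 * b + 1)) = -(-1 : ℝ) ^ n := by
  rw [zpow_add₀ (by norm_num), Odd.neg_one_zpow ⟨b, rfl⟩]
  ring

/-- If `f` is the modulation of `f'` up to the constant `c`, filtering `x` with `f` amounts to
filtering the modulation of `x` with `f'`. -/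
theorem fbCoeff_modSeq {f f' : ℤ → ℝ} {c : ℝ} (hf : ∀ n, f n = c * ((-1 : ℝ) ^ n * f' n))
    (x : ℤ → ℝ) (m : ℤ) : fbCoeff f x m = c * fbCoeff f' (modSeq x) m := by
  unfold fbCoeff conv
  rw [← smul_eq_mul c, smul_finsum]
  refine finsum_congr fun k => ?_
  have hk : (-1 : ℝ) ^ (2 * m - k) = (-1 : ℝ) ^ k := by
    rw [zpow_sub₀ (by norm_num), Even.neg_one_zpow (even_two_mul m), one_div, ← inv_zpow]
    norm_num
  rw [hf, modSeq, hk, smul_eq_mul]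
  ring

/-- Synthesis from reverse-ordered complementary coefficients yields
the modulated signal. -/
theorem ROSS_modulation_synthesis (g h : ZMod 2 → ℤ → ℝ)
    (hg : ∀ i : ZMod 2, (Function.support (g i)).Finite)
    (hh : ∀ i : ZMod 2, (Function.support (h i)).Finite)
    (a : ℝ) (b : ℤ) (ha : a ≠ 0)
    (hPR : IsPR g h) (hsym : SymmAS g h a b)
    (x : ℤ → ℝ) (n : ℤ) :
    (∑ᶠ m : ℤ, h 0 (n - 2 * m) * fbCoeff (compG a b (h 1)) x m)
      - (∑ᶠ m : ℤ, h 1 (n - 2 * m) * fbCoeff (compG a b (h 0)) x m)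
      = (-1 : ℝ) ^ n * x n := by
  have hsq : ∀ k : ℤ, (-1 : ℝ) ^ k * (-1 : ℝ) ^ k = 1 := fun k => by
    rw [← mul_zpow]
    norm_num
  have h1 : ∀ k, compG a b (h 1) k = 1 * ((-1 : ℝ) ^ k * g 0 k) := fun k => by
    have hk := congrFun (hsym.eq_modSeq_shift hg hh 0) k
    simp only [show (1 - 0 : ZMod 2) = 1 from rfl, show (1 : ZMod 2).val = 1 from rfl,
      modSeq, neg_one_zpow_add_odd] at hk
    rw [hk, compG]
    linear_combination (-a * h 1 (k + (2 * b + 1))) * hsq k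
  have h0 : ∀ k, compG a b (h 0) k = (-1) * ((-1 : ℝ) ^ k * g 1 k) := fun k => by
    have hk := congrFun (hsym.eq_modSeq_shift hg hh 1) k
    simp only [show (1 - 1 : ZMod 2) = 0 from rfl, show (0 : ZMod 2).val = 0 from rfl,
      modSeq, neg_one_zpow_add_odd] at hk
    rw [hk, compG]
    linear_combination (-a * h 0 (k + (2 * b + 1))) * hsq k
  have hrec := hPR (modSeq x) n
  rw [show (∑ i : ZMod 2, ∑ᶠ m : ℤ, h i (n - 2 * m) * fbCoeff (g i) (modSeq x) m)
    = (∑ᶠ m : ℤ, h 0 (n - 2 * m) * fbCoeff (g 0) (modSeq x) m)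
      + ∑ᶠ m : ℤ, h 1 (n - 2 * m) * fbCoeff (g 1) (modSeq x) m from Fin.sum_univ_two _] at hrec
  simp only [fbCoeff_modSeq h1, fbCoeff_modSeq h0, one_mul, neg_mul, mul_neg, finsum_neg_distrib,
    sub_neg_eq_add]
  exact hrec.symm
end
end

section
/- (Localized Aliasing) Let {g_i, h_i}_{i∈{0,1}} be a perfect reconstruction filterbank with finitely supported filters that satisfies the analysis–synthesis symmetry with parameters (a,b). Then for every x : ℤ → ℝ, i ∈ {0,1}, and n ∈ ℤ: v^{x_s}_i[n] = (1/2)·(v^x_i[n] + (−1)^i·w^x_{1−i}[n]), and moreover v^{x_s}_i[n] = (−1)^i·w^{x_s}_{1−i}[n]. -/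
open scoped BigOperators

noncomputable section

/-- The character `ω ↦ exp(−i·n·ω)` of the additive group of the reals. -/
def expChar (n : ℤ) : Multiplicative ℝ →* ℂ where
  toFun ω := Complex.exp (-(Complex.I * (n : ℂ) * ((Multiplicative.toAdd ω : ℝ) : ℂ)))
  map_one' := by simp
  map_mul' ω ν := by
    rw [← Complex.exp_add, toAdd_mul]
    push_cast
    ring_nf

theorem expChar_ofAdd (n : ℤ) (ω : ℝ) :
    expChar n (Multiplicative.ofAdd ω) = Complex.exp (-(Complex.I * (n : ℂ) * (ω : ℂ))) :=
  rfl

theorem expChar_injective : Function.Injective expChar := by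
  intro n m hnm
  by_contra hne
  have hd : (n : ℂ) - (m : ℂ) ≠ 0 := sub_ne_zero.mpr (by exact_mod_cast hne)
  have h := DFunLike.congr_fun hnm (Multiplicative.ofAdd (Real.pi / ((n : ℝ) - (m : ℝ))))
  rw [expChar_ofAdd, expChar_ofAdd] at h
  have harg : -(Complex.I * (m : ℂ) * ((Real.pi / ((n : ℝ) - (m : ℝ)) : ℝ) : ℂ))
      = -(Complex.I * (n : ℂ) * ((Real.pi / ((n : ℝ) - (m : ℝ)) : ℝ) : ℂ))
        + Real.pi * Complex.I := by
    push_cast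
    field_simp
    ring
  rw [harg, Complex.exp_add, Complex.exp_pi_mul_I] at h
  exact Complex.exp_ne_zero _ (self_eq_neg.mp (by simpa using h))

theorem dtft_eq_sum {f : ℤ → ℝ} {s : Finset ℤ} (hs : Function.support f ⊆ s) (ω : ℝ) :
    dtft f ω = ∑ n ∈ s, (f n : ℂ) * Complex.exp (-(Complex.I * (n : ℂ) * (ω : ℂ))) := by
  refine finsum_eq_sum_of_support_subset _ fun n hn => hs ?_
  rw [Function.mem_support] at hn ⊢
  intro h0
  simp [h0] at hn

theorem dtft_shift (f : ℤ → ℝ) (k : ℤ) (ω : ℝ) :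
    dtft (fun n => f (n + k)) ω = Complex.exp (Complex.I * (k : ℂ) * (ω : ℂ)) * dtft f ω := by
  simp only [dtft]
  rw [← smul_eq_mul, smul_finsum]
  conv_rhs => rw [← finsum_comp_equiv (Equiv.addRight k)]
  refine finsum_congr fun n => ?_
  rw [smul_eq_mul, mul_left_comm, ← Complex.exp_add, Equiv.coe_addRight]
  push_cast
  ring_nf

theorem dtft_modSeq (f : ℤ → ℝ) (ω : ℝ) : dtft (modSeq f) ω = dtft f (ω - Real.pi) := by
  refine finsum_congr fun n => ?_
  have harg : -(Complex.I * (n : ℂ) * ((ω - Real.pi : ℝ) : ℂ))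
      = (n : ℂ) * (Real.pi * Complex.I) + -(Complex.I * (n : ℂ) * (ω : ℂ)) := by
    push_cast
    ring
  rw [harg, Complex.exp_add, Complex.exp_int_mul, Complex.exp_pi_mul_I, modSeq]
  push_cast
  ring

/-- In the time domain, the analysis–synthesis symmetry says that each complementary filter
is, up to sign, a modulated analysis filter. -/
theorem SymmAS.compG_eq {g h : ZMod 2 → ℤ → ℝ} {a : ℝ} {b : ℤ} (hsym : SymmAS g h a b)
    (hg : ∀ i : ZMod 2, (Function.support (g i)).Finite)
    (hh : ∀ i : ZMod 2, (Function.support (h i)).Finite) (i : ZMod 2) (n : ℤ) :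
    (-1 : ℝ) ^ i.val * compG a b (h (1 - i)) n = modSeq (g i) n := by
  have hfin : (Function.support fun n => ((-1 : ℝ) ^ (1 - i : ZMod 2).val * a)
      * modSeq (h (1 - i)) (n + (2 * b + 1))).Finite := by
    refine ((hh (1 - i)).preimage (add_left_injective (2 * b + 1)).injOn).subset fun m hm => ?_
    simp only [Function.mem_support, Set.mem_preimage, modSeq] at hm ⊢
    intro h0
    simp [h0] at hm
  have hgi := congrFun (eq_of_dtft_eq (hg i) hfin fun ω => by
    rw [dtft_const_mul, dtft_shift, dtft_modSeq, hsym i ω]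
    push_cast
    ring) n
  have hsign : (-1 : ℝ) ^ i.val = -(-1 : ℝ) ^ (1 - i : ZMod 2).val := by
    fin_cases i
    · change (-1 : ℝ) ^ 0 = -(-1 : ℝ) ^ 1
      norm_num
    · change (-1 : ℝ) ^ 1 = -(-1 : ℝ) ^ 0
      norm_num
  have hodd : (-1 : ℝ) ^ (2 * b + 1) = -1 := Odd.neg_one_zpow ⟨b, rfl⟩
  have hsq : (-1 : ℝ) ^ n * (-1 : ℝ) ^ n = 1 := by rw [← mul_zpow]; norm_num
  rw [modSeq, hgi, modSeq, zpow_add₀ (by norm_num), hodd, hsign, compG]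
  linear_combination ((-1 : ℝ) ^ (1 - i : ZMod 2).val * a * h (1 - i) (n + (2 * b + 1))) * hsq

theorem conv_eq_sum {f : ℤ → ℝ} {s : Finset ℤ} (hs : Function.support f ⊆ s) (x : ℤ → ℝ)
    (n : ℤ) : conv f x n = ∑ m ∈ s, f m * x (n - m) := by
  refine finsum_eq_sum_of_support_subset _ fun m hm => hs ?_
  exact left_ne_zero_of_mul hm

theorem conv_const_mul (c : ℝ) (f x : ℤ → ℝ) (n : ℤ) :
    conv (fun m => c * f m) x n = c * conv f x n := by
  simp only [conv, mul_assoc]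
  rw [← smul_eq_mul, smul_finsum]
  rfl

theorem support_modSeq (f : ℤ → ℝ) : Function.support (modSeq f) = Function.support f := by
  ext n
  simp [modSeq, zpow_ne_zero]

theorem fbCoeff_subSeq {f : ℤ → ℝ} (hf : (Function.support f).Finite) (x : ℤ → ℝ) (n : ℤ) :
    fbCoeff f (subSeq x) n = (1 / 2) * (fbCoeff f x n + fbCoeff (modSeq f) x n) := by
  have hs : Function.support f ⊆ hf.toFinset := by simp
  have hs' : Function.support (modSeq f) ⊆ hf.toFinset := by simp [support_modSeq]
  simp only [fbCoeff]
  rw [conv_eq_sum hs, conv_eq_sum hs, conv_eq_sum hs', ← Finset.sum_add_distrib, Finset.mul_sum]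
  refine Finset.sum_congr rfl fun m _ => ?_
  rcases Int.even_or_odd m with hm | hm
  · rw [subSeq, if_pos ((even_two_mul n).sub hm), modSeq, hm.neg_one_zpow]
    ring
  · rw [subSeq, if_neg (Int.not_even_iff_odd.mpr ((even_two_mul n).sub_odd hm)), modSeq,
      hm.neg_one_zpow]
    ring

theorem fbCoeff_modSeq_subSeq (f x : ℤ → ℝ) (n : ℤ) :
    fbCoeff (modSeq f) (subSeq x) n = fbCoeff f (subSeq x) n := by
  refine finsum_congr fun m => ?_
  rcases Int.even_or_odd m with hm | hm
  · rw [modSeq, hm.neg_one_zpow, one_mul]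
  · rw [subSeq, if_neg (Int.not_even_iff_odd.mpr ((even_two_mul n).sub_odd hm)), mul_zero, mul_zero]

/-- Localized aliasing. -/
theorem localized_aliasing (g h : ZMod 2 → ℤ → ℝ)
    (hg : ∀ i : ZMod 2, (Function.support (g i)).Finite)
    (hh : ∀ i : ZMod 2, (Function.support (h i)).Finite)
    (a : ℝ) (b : ℤ) (ha : a ≠ 0)
    (hPR : IsPR g h) (hsym : SymmAS g h a b)
    (x : ℤ → ℝ) (i : ZMod 2) (n : ℤ) :
    fbCoeff (g i) (subSeq x) n
      = (1 / 2) * (fbCoeff (g i) x n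
          + (-1 : ℝ) ^ i.val * fbCoeff (compG a b (h (1 - i))) x n) ∧
    fbCoeff (g i) (subSeq x) n
      = (-1 : ℝ) ^ i.val * fbCoeff (compG a b (h (1 - i))) (subSeq x) n := by
  have hcomp (y : ℤ → ℝ) : (-1 : ℝ) ^ i.val * fbCoeff (compG a b (h (1 - i))) y n
      = fbCoeff (modSeq (g i)) y n := by
    rw [fbCoeff, ← conv_const_mul, fbCoeff, funext (hsym.compG_eq hg hh i)]
  rw [hcomp, hcomp]
  exact ⟨fbCoeff_subSeq (hg i) x n, (fbCoeff_modSeq_subSeq (g i) x n).symm⟩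
end
end

section
/- (Localized Amplitude Modulation) Let L ≥ 1 and K ≥ 1. For each k ∈ {1,…,K}, let x_k, y_k : ℤ → ℝ and j_k : ℤ → (ℤ/2ℤ)^L be such that the L-level Haar coefficients of y_k satisfy v^{y_k}_𝐢[n] = 2^L if 𝐢 = j_k[n] and v^{y_k}_𝐢[n] = 0 otherwise. Let z[n] = Σ_{k=1}^K x_k[n]·y_k[n]. If for every n ∈ ℤ and every 𝐢 ∈ (ℤ/2ℤ)^L at most one index k satisfies v^{x_k}_{𝐢+j_k[n]}[n] ≠ 0, then for all k, all 𝐢 ∈ (ℤ/2ℤ)^L, and all n ∈ ℤ with v^{x_k}_𝐢[n] ≠ 0 one has v^z_{𝐢+j_k[n]}[n] = v^{x_k}_𝐢[n]. -/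
open scoped BigOperators

noncomputable section

/-- The one-level Haar coefficients are sums and differences of neighbouring samples. -/
theorem fbCoeff_haarG (i : ZMod 2) (x : ℤ → ℝ) (n : ℤ) :
    fbCoeff (haarG i) x n = x (2 * n) + (-1 : ℝ) ^ i.val * x (2 * n + 1) := by
  have hs : (Function.support fun m : ℤ => haarG i m * x (2 * n - m)) ⊆
      (({0, -1} : Finset ℤ) : Set ℤ) := by
    intro m hm
    by_contra h
    simp only [Finset.coe_insert, Finset.coe_singleton, Set.mem_insert_iff,
      Set.mem_singleton_iff, not_or] at h
    exact hm (by simp [haarG, h.1, h.2])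
  rw [fbCoeff, conv, finsum_eq_sum_of_support_subset _ hs]
  simp [haarG]

theorem fbCoeff_haarG_add (i : ZMod 2) (x y : ℤ → ℝ) :
    fbCoeff (haarG i) (x + y) = fbCoeff (haarG i) x + fbCoeff (haarG i) y := by
  funext n
  simp only [fbCoeff_haarG, Pi.add_apply]
  ring

theorem fbCoeff_haarG_smul (i : ZMod 2) (c : ℝ) (x : ℤ → ℝ) :
    fbCoeff (haarG i) (c • x) = c • fbCoeff (haarG i) x := by
  funext n
  simp only [fbCoeff_haarG, Pi.smul_apply, smul_eq_mul]
  ring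

theorem mCoeff_haarG_add {L : ℕ} (i : Fin L → ZMod 2) (x y : ℤ → ℝ) :
    mCoeff haarG L i (x + y) = mCoeff haarG L i x + mCoeff haarG L i y := by
  induction L generalizing x y with
  | zero => rfl
  | succ L ih => simp only [mCoeff, fbCoeff_haarG_add, ih]

theorem mCoeff_haarG_smul {L : ℕ} (i : Fin L → ZMod 2) (c : ℝ) (x : ℤ → ℝ) :
    mCoeff haarG L i (c • x) = c • mCoeff haarG L i x := by
  induction L generalizing x with
  | zero => rfl
  | succ L ih => simp only [mCoeff, fbCoeff_haarG_smul, ih]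

/-- The `L`-level Haar coefficients as a linear map of the sequence. -/
def mCoeffHaarLinear {L : ℕ} (i : Fin L → ZMod 2) : (ℤ → ℝ) →ₗ[ℝ] (ℤ → ℝ) where
  toFun := mCoeff haarG L i
  map_add' := mCoeff_haarG_add i
  map_smul' := mCoeff_haarG_smul i

theorem mCoeff_haarG_sum {L : ℕ} {ι : Type*} (s : Finset ι) (i : Fin L → ZMod 2)
    (x : ι → ℤ → ℝ) (n : ℤ) :
    mCoeff haarG L i (∑ k ∈ s, x k) n = ∑ k ∈ s, mCoeff haarG L i (x k) n := by
  have h := congrFun (map_sum (mCoeffHaarLinear i) x s) n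
  rwa [Finset.sum_apply] at h

/-- One-level Haar coefficients of a product are a convolution over `ZMod 2`. -/
theorem two_smul_fbCoeff_haarG_mul (i : ZMod 2) (x y : ℤ → ℝ) :
    (2 : ℝ) • fbCoeff (haarG i) (x * y) =
      ∑ a : ZMod 2, fbCoeff (haarG (i + a)) x * fbCoeff (haarG a) y := by
  have key : ∀ f : ZMod 2 → ℤ → ℝ, ∑ a : ZMod 2, f a = f 0 + f 1 := Fin.sum_univ_two
  have h11 : (1 : ZMod 2) + 1 = 0 := rfl
  have h1 : (1 : ZMod 2).val = 1 := rfl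
  have hi : i = 0 ∨ i = 1 := by revert i; decide
  rw [key]
  funext n
  rcases hi with rfl | rfl <;>
  · simp only [Pi.smul_apply, smul_eq_mul, Pi.add_apply, Pi.mul_apply, fbCoeff_haarG, add_zero,
      zero_add, h11, h1, ZMod.val_zero, pow_zero, pow_one]
    ring

/-- The `L`-level Haar coefficients of a product are a convolution over `(ZMod 2)^L`. -/
theorem two_pow_mul_mCoeff_haarG_mul {L : ℕ} (i : Fin L → ZMod 2) (x y : ℤ → ℝ) (n : ℤ) :
    (2 : ℝ) ^ L * mCoeff haarG L i (x * y) n =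
      ∑ a : Fin L → ZMod 2, mCoeff haarG L (i + a) x n * mCoeff haarG L a y n := by
  induction L generalizing x y with
  | zero => simp [mCoeff]
  | succ L ih =>
    rw [← (Fin.consEquiv fun _ : Fin (L + 1) => ZMod 2).sum_comp, Fintype.sum_prod_type]
    have hstep : 2 * mCoeff haarG (L + 1) i (x * y) n =
        mCoeff haarG L (fun t => i t.succ) ((2 : ℝ) • fbCoeff (haarG (i 0)) (x * y)) n := by
      rw [mCoeff_haarG_smul]
      rfl
    rw [pow_succ, mul_assoc, hstep, two_smul_fbCoeff_haarG_mul, mCoeff_haarG_sum,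
      Finset.mul_sum]
    refine Finset.sum_congr rfl fun a _ => ?_
    rw [ih]
    rfl

/-- If the Haar coefficients of `y` at `n` are concentrated at the index `j`, then multiplication
by `y` shifts the Haar indices at `n` by `j`. -/
theorem mCoeff_haarG_mul_of_concentrated {L : ℕ} (i j : Fin L → ZMod 2) (x y : ℤ → ℝ) (n : ℤ)
    (hy : ∀ a, mCoeff haarG L a y n = if a = j then (2 : ℝ) ^ L else 0) :
    mCoeff haarG L i (x * y) n = mCoeff haarG L (i + j) x n := by
  have h := two_pow_mul_mCoeff_haarG_mul i x y n
  simp only [hy, mul_ite, mul_zero, Finset.sum_ite_eq', Finset.mem_univ, if_true] at h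
  rw [mul_comm] at h
  exact mul_right_cancel₀ (by positivity) h

/-- Localized amplitude modulation. -/
theorem localized_amplitude_modulation (L K : ℕ)
    (x y : Fin (K + 1) → ℤ → ℝ)
    (j : Fin (K + 1) → ℤ → (Fin (L + 1) → ZMod 2))
    (hy : ∀ (k : Fin (K + 1)) (i : Fin (L + 1) → ZMod 2) (n : ℤ),
      mCoeff haarG (L + 1) i (y k) n = if i = j k n then (2 : ℝ) ^ (L + 1) else 0)
    (z : ℤ → ℝ) (hz : ∀ n : ℤ, z n = ∑ k : Fin (K + 1), x k n * y k n)
    (hexcl : ∀ (n : ℤ) (i : Fin (L + 1) → ZMod 2) (k k' : Fin (K + 1)),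
      mCoeff haarG (L + 1) (i + j k n) (x k) n ≠ 0 →
      mCoeff haarG (L + 1) (i + j k' n) (x k') n ≠ 0 → k = k') :
    ∀ (k : Fin (K + 1)) (i : Fin (L + 1) → ZMod 2) (n : ℤ),
      mCoeff haarG (L + 1) i (x k) n ≠ 0 →
      mCoeff haarG (L + 1) (i + j k n) z n = mCoeff haarG (L + 1) i (x k) n := by
  intro k i n hk
  have hz' : z = ∑ k, x k * y k := by
    funext m
    simp [hz, Finset.sum_apply]
  have hi : i + j k n + j k n = i := by
    funext t
    simp [add_assoc, CharTwo.add_self_eq_zero]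
  rw [hz', mCoeff_haarG_sum]
  simp only [fun k' => mCoeff_haarG_mul_of_concentrated (i + j k n) (j k' n) (x k') (y k') n
    fun a => hy k' a n]
  rw [Finset.sum_eq_single k, hi]
  · intro k' _ hne
    by_contra h
    exact hne (hexcl n (i + j k n) k' k h (by rwa [hi]))
  · simp
end
end
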